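/- Let M be a model of ZFC(∈₁) ∪ ZFC(∈₂). For all elements x, x', y, y' of M: if φ(x,y) and φ(x',y') hold in M, then x ∈₁ x' if and only if y ∈₂ y'. -/

import Mathlib

universe u

/-! ## Syntax of the first-order language `L = {∈₁, ∈₂}`

Formulas of the first-order language with two binary relation symbols `∈₁`
and `∈₂` (and equality), with variables indexed by `ℕ`. -/
inductive Fml : Type
  | mem1 : ℕ → ℕ → Fml
  | mem2 : ℕ → ℕ → Fml
  | eq   : ℕ → ℕ → Fml
  | fal  : Fml
  | imp  : Fml → Fml → Fml
  | all  : ℕ → Fml → Fml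

/-- Satisfaction of an `L`-formula in a structure `(M, e₁, e₂)` under a
valuation `v : ℕ → M` of the variables. -/
def Fml.Sat {M : Type u} (e₁ e₂ : M → M → Prop) : Fml → (ℕ → M) → Prop
  | .mem1 i j, v => e₁ (v i) (v j)
  | .mem2 i j, v => e₂ (v i) (v j)
  | .eq i j,   v => v i = v j
  | .fal,      _ => False
  | .imp φ ψ,  v => φ.Sat e₁ e₂ v → ψ.Sat e₁ e₂ v
  | .all n φ,  v => ∀ a : M, φ.Sat e₁ e₂ (Function.update v n a)

/-! ## The ZFC axioms, with membership relation `e`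

The Separation and Replacement schemas range over all `L`-formulas, i.e. the
formulas may mention both `∈₁` and `∈₂`; the remaining axioms only mention
the membership relation `e` itself. -/

def Extensionality {M : Type u} (e : M → M → Prop) : Prop :=
  ∀ x y : M, (∀ t, e t x ↔ e t y) → x = y

def Foundation {M : Type u} (e : M → M → Prop) : Prop :=
  ∀ x : M, (∃ t, e t x) → ∃ t, e t x ∧ ∀ s, e s t → ¬ e s x

def Pairing {M : Type u} (e : M → M → Prop) : Prop :=
  ∀ x y : M, ∃ p : M, ∀ t, e t p ↔ (t = x ∨ t = y)

def UnionAx {M : Type u} (e : M → M → Prop) : Prop :=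
  ∀ x : M, ∃ u : M, ∀ t, e t u ↔ ∃ s, e s x ∧ e t s

def PowerSetAx {M : Type u} (e : M → M → Prop) : Prop :=
  ∀ x : M, ∃ p : M, ∀ t, e t p ↔ ∀ s, e s t → e s x

def InfinityAx {M : Type u} (e : M → M → Prop) : Prop :=
  ∃ w : M, (∃ z, e z w ∧ ∀ t, ¬ e t z) ∧
    ∀ t, e t w → ∃ s, e s w ∧ ∀ u, e u s ↔ (e u t ∨ u = t)

/-- The axiom of choice: every set of nonempty pairwise disjoint sets has a
choice set. -/
def ChoiceAx {M : Type u} (e : M → M → Prop) : Prop :=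
  ∀ x : M, (∀ t, e t x → ∃ s, e s t) →
    (∀ t t', e t x → e t' x → t ≠ t' → ¬ ∃ s, e s t ∧ e s t') →
    ∃ c : M, ∀ t, e t x → ∃! s, e s t ∧ e s c

/-- The Separation Schema for the membership relation `e`, where the
formulas range over all `L`-formulas (interpreted with `∈₁ := e₁`,
`∈₂ := e₂`) and may use parameters (supplied by the valuation `v`);
variable `0` is the variable being separated on. -/
def SeparationSchema {M : Type u} (e e₁ e₂ : M → M → Prop) : Prop :=
  ∀ (φ : Fml) (v : ℕ → M) (a : M), ∃ b : M,
    ∀ t : M, e t b ↔ (e t a ∧ φ.Sat e₁ e₂ (Function.update v 0 t))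

/-- The Replacement Schema for the membership relation `e`, where the
formulas range over all `L`-formulas (interpreted with `∈₁ := e₁`,
`∈₂ := e₂`) and may use parameters; variables `0` and `1` are the
argument/value variables of the class function defined by `φ`. -/
def ReplacementSchema {M : Type u} (e e₁ e₂ : M → M → Prop) : Prop :=
  ∀ (φ : Fml) (v : ℕ → M) (a : M),
    (∀ t, e t a → ∃! s, φ.Sat e₁ e₂ (Function.update (Function.update v 0 t) 1 s)) →
    ∃ b : M, ∀ t, e t a → ∀ s,
      φ.Sat e₁ e₂ (Function.update (Function.update v 0 t) 1 s) → e s b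

/-- A model `(M, ∈₁, ∈₂)` of `ZFC(∈₁) ∪ ZFC(∈₂)`: the first-order ZFC axioms
hold for the membership relation `∈₁`, with the Separation and Replacement
schemas ranging over all formulas of the language `L = {∈₁, ∈₂}`, and
likewise for the membership relation `∈₂`. -/
structure ZFC2Model (M : Type u) : Type u where
  mem1 : M → M → Prop
  mem2 : M → M → Prop
  ext1 : Extensionality mem1
  found1 : Foundation mem1
  pair1 : Pairing mem1
  union1 : UnionAx mem1
  power1 : PowerSetAx mem1
  infinity1 : InfinityAx mem1
  choice1 : ChoiceAx mem1
  sep1 : SeparationSchema mem1 mem1 mem2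
  repl1 : ReplacementSchema mem1 mem1 mem2
  ext2 : Extensionality mem2
  found2 : Foundation mem2
  pair2 : Pairing mem2
  union2 : UnionAx mem2
  power2 : PowerSetAx mem2
  infinity2 : InfinityAx mem2
  choice2 : ChoiceAx mem2
  sep2 : SeparationSchema mem2 mem1 mem2
  repl2 : ReplacementSchema mem2 mem1 mem2

/-! ## Defined notions, relative to a membership relation `e` -/

/-- `u` is a transitive set in the sense of `e`. -/
def IsTransSet {M : Type u} (e : M → M → Prop) (x : M) : Prop :=
  ∀ t, e t x → ∀ w, e w t → e w x

/-- `u` is the `e`-transitive closure `TC(x)` of `x`: the least transitive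
set containing all `e`-elements of `x`. -/
def IsTC {M : Type u} (e : M → M → Prop) (x u : M) : Prop :=
  IsTransSet e u ∧ (∀ v, e v x → e v u) ∧
    ∀ v, IsTransSet e v → (∀ w, e w x → e w v) → ∀ w, e w u → e w v

/-- `s` is the singleton `{x}` in the sense of `e`. -/
def IsSingleton {M : Type u} (e : M → M → Prop) (x s : M) : Prop :=
  ∀ t, e t s ↔ t = x

/-- `p` is the (Kuratowski) ordered pair `⟨a, b⟩ = {{a}, {a, b}}` in the
sense of `e`. -/
def IsOPair {M : Type u} (e : M → M → Prop) (a b p : M) : Prop :=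
  ∃ sa pab : M, IsSingleton e a sa ∧ (∀ t, e t pab ↔ (t = a ∨ t = b)) ∧
    (∀ t, e t p ↔ (t = sa ∨ t = pab))

/-- `f(a) = b` in the sense of `e`: the ordered pair `⟨a, b⟩` is an
`e`-element of `f`. -/
def FunVal {M : Type u} (e : M → M → Prop) (f a b : M) : Prop :=
  ∃ p, e p f ∧ IsOPair e a b p

/-- In the sense of `e`, the set `f` is a function with domain `d`. -/
def IsFuncOn {M : Type u} (e : M → M → Prop) (f d : M) : Prop :=
  (∀ p, e p f → ∃ a b, e a d ∧ IsOPair e a b p) ∧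
  (∀ a, e a d → ∃ b, FunVal e f a b) ∧
  (∀ a b b', FunVal e f a b → FunVal e f a b' → b = b')

/-- `On(α)` in the sense of `e`: `α` is an ordinal, i.e. a transitive set of
transitive sets. -/
def IsOrd {M : Type u} (e : M → M → Prop) (α : M) : Prop :=
  IsTransSet e α ∧ ∀ t, e t α → IsTransSet e t

/-- `v = V_α`, the `α`-th level of the cumulative hierarchy in the sense of
`e`: there is a function `g` (in the sense of `e`) with domain `α ∪ {α}`
such that `g(β) = { t : t ⊆ g(γ) for some γ ∈ β }` for every `β ∈ α ∪ {α}`,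
and `v = g(α)`. -/
def IsVLevel {M : Type u} (e : M → M → Prop) (α v : M) : Prop :=
  ∃ g s : M, (∀ t, e t s ↔ (e t α ∨ t = α)) ∧ IsFuncOn e g s ∧
    (∀ β, e β s → ∀ gβ, FunVal e g β gβ → ∀ t,
      (e t gβ ↔ ∃ γ, e γ β ∧ ∃ gγ, FunVal e g γ gγ ∧ ∀ w, e w t → e w gγ)) ∧
    FunVal e g α v

/-! ## The formulas `ψ(x, y, f)` and `φ(x, y)` -/

/-- The formula `ψ(x, y, f)` of Väänänen's paper, asserting that (i) in the
sense of `∈₁`, `f` is a function with domain `TC₁({x})`; (ii) `f` maps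
`TC₁(x)` into `TC₂(y)`; (iii) `f` maps `TC₁(x)` onto `TC₂(y)`; (iv) for all
`t ∈₁ TC₁(x)` and `w ∈₁ TC₁({x})`, `t ∈₁ w ↔ f(t) ∈₂ f(w)`; and (v)
`f(x) = y`.  (Here `f` is applied in the sense of `∈₁`.) -/
def Psi {M : Type u} (e₁ e₂ : M → M → Prop) (x y f : M) : Prop :=
  ∃ sx tcsx tcx tcy : M,
    IsSingleton e₁ x sx ∧ IsTC e₁ sx tcsx ∧ IsTC e₁ x tcx ∧ IsTC e₂ y tcy ∧
    -- (i)
    IsFuncOn e₁ f tcsx ∧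
    -- (ii)
    (∀ t, e₁ t tcx → ∀ ft, FunVal e₁ f t ft → e₂ ft tcy) ∧
    -- (iii)
    (∀ t, e₂ t tcy → ∃ w, e₁ w tcx ∧ FunVal e₁ f w t) ∧
    -- (iv)
    (∀ t, e₁ t tcx → ∀ w, e₁ w tcsx → ∀ ft fw,
      FunVal e₁ f t ft → FunVal e₁ f w fw → (e₁ t w ↔ e₂ ft fw)) ∧
    -- (v)
    FunVal e₁ f x y

/-- The formula `φ(x, y) := ∃f ψ(x, y, f)`. -/
def Phi {M : Type u} (e₁ e₂ : M → M → Prop) (x y : M) : Prop :=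
  ∃ f, Psi e₁ e₂ x y f

namespace Fml

def neg (p : Fml) : Fml := .imp p .fal
def conj (p q : Fml) : Fml := neg (.imp p (neg q))
def disj (p q : Fml) : Fml := .imp (neg p) q
def bic (p q : Fml) : Fml := conj (.imp p q) (.imp q p)
def ex (n : ℕ) (p : Fml) : Fml := neg (.all n (neg p))

variable {M : Type u} (e₁ e₂ : M → M → Prop) (v : ℕ → M)

theorem sat_neg (p : Fml) : (neg p).Sat e₁ e₂ v ↔ ¬ p.Sat e₁ e₂ v := Iff.rfl

theorem sat_conj (p q : Fml) :
    (conj p q).Sat e₁ e₂ v ↔ (p.Sat e₁ e₂ v ∧ q.Sat e₁ e₂ v) := by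
  simp only [conj, neg, Fml.Sat]; tauto

theorem sat_disj (p q : Fml) :
    (disj p q).Sat e₁ e₂ v ↔ (p.Sat e₁ e₂ v ∨ q.Sat e₁ e₂ v) := by
  simp only [disj, neg, Fml.Sat]; tauto

theorem sat_bic (p q : Fml) :
    (bic p q).Sat e₁ e₂ v ↔ (p.Sat e₁ e₂ v ↔ q.Sat e₁ e₂ v) := by
  simp only [bic, sat_conj, Fml.Sat]; tauto

theorem sat_ex (n : ℕ) (p : Fml) :
    (ex n p).Sat e₁ e₂ v ↔ ∃ a, p.Sat e₁ e₂ (Function.update v n a) := by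
  simp only [ex, neg, Fml.Sat]
  constructor
  · intro h
    by_contra hc
    exact h fun a ha => hc ⟨a, ha⟩
  · rintro ⟨a, ha⟩ h
    exact h a ha

/-- The formula expressing `f(a) = b` in the sense of `∈₁`. -/
def fv (f a b : ℕ) : Fml :=
  ex 10 (conj (.mem1 10 f) (ex 11 (ex 12 (conj
    (.all 13 (bic (.mem1 13 11) (.eq 13 a)))
    (conj (.all 13 (bic (.mem1 13 12) (disj (.eq 13 a) (.eq 13 b))))
      (.all 13 (bic (.mem1 13 10) (disj (.eq 13 11) (.eq 13 12)))))))))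

theorem sat_fv (f a b : ℕ) (hf : f < 10) (ha : a < 10) (hb : b < 10) :
    (fv f a b).Sat e₁ e₂ v ↔ FunVal e₁ (v f) (v a) (v b) := by
  have h1 : ∀ k n : ℕ, k < 10 → 10 ≤ n → k ≠ n := by intros; omega
  simp [fv, sat_ex, sat_conj, sat_bic, sat_disj, Fml.Sat, Function.update_apply,
    h1 _ _ hf, h1 _ _ ha, h1 _ _ hb, FunVal, IsOPair, IsSingleton]

end Fml

section Aux
open Fml

variable {M : Type u} (Z : ZFC2Model M)

/-- Every element of `TC₁({x})` is in `TC₁(x)` or equals `x`. -/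
theorem tc_singleton {x sx D T : M} (hs : IsSingleton Z.mem1 x sx)
    (hD : IsTC Z.mem1 sx D) (hT : IsTC Z.mem1 x T) :
    Z.mem1 x D ∧ (∀ t, Z.mem1 t T → Z.mem1 t D) ∧
      ∀ t, Z.mem1 t D → Z.mem1 t T ∨ t = x := by
  have hx : Z.mem1 x D := hD.2.1 x ((hs x).2 rfl)
  refine ⟨hx, hT.2.2 D hD.1 fun w hw => hD.1 x hx w hw, ?_⟩
  obtain ⟨b, hb⟩ := Z.sep1 (disj (.mem1 0 1) (.eq 0 2))
    (fun n => if n = 1 then T else x) D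
  simp only [sat_disj, Fml.Sat, Function.update_apply] at hb
  norm_num at hb
  intro t ht
  refine ((hb t).1 (hD.2.2 b ?_ ?_ t ht)).2
  · intro t ht w hw
    obtain ⟨h1, h2⟩ := (hb t).1 ht
    refine (hb w).2 ⟨hD.1 t h1 w hw, Or.inl ?_⟩
    rcases h2 with h2 | rfl
    · exact hT.1 t h2 w hw
    · exact hT.2.1 w hw
  · intro w hw
    have := (hs w).1 hw
    subst this
    exact (hb w).2 ⟨hx, Or.inr rfl⟩

/-- The useful content of `ψ`. -/
structure Good (x y f D : M) : Prop where
  xD : Z.mem1 x D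
  trans : ∀ t, Z.mem1 t D → ∀ w, Z.mem1 w t → Z.mem1 w D
  tot : ∀ t, Z.mem1 t D → ∃ b, FunVal Z.mem1 f t b
  uniq : ∀ a b b', FunVal Z.mem1 f a b → FunVal Z.mem1 f a b' → b = b'
  fwd : ∀ w, Z.mem1 w D → ∀ t, Z.mem1 t w → ∀ ft fw,
    FunVal Z.mem1 f t ft → FunVal Z.mem1 f w fw → Z.mem2 ft fw
  bwd : ∀ w, Z.mem1 w D → ∀ fw, FunVal Z.mem1 f w fw → ∀ s, Z.mem2 s fw →
    ∃ t, Z.mem1 t w ∧ FunVal Z.mem1 f t s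
  val : FunVal Z.mem1 f x y

theorem good_of_psi {x y f : M} (h : Psi Z.mem1 Z.mem2 x y f) : ∃ D, Good Z x y f D := by
  obtain ⟨sx, D, T, Y, hs, hD, hT, hY, hf, h2, h3, h4, h5⟩ := h
  obtain ⟨hx, hTD, hDT⟩ := tc_singleton Z hs hD hT
  have key : ∀ w, Z.mem1 w D → ∀ t, Z.mem1 t w → Z.mem1 t T := by
    intro w hw t ht
    rcases hDT w hw with h | rfl
    · exact hT.1 w h t ht
    · exact hT.2.1 t ht
  refine ⟨D, hx, hD.1, hf.2.1, hf.2.2, ?_, ?_, h5⟩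
  · intro w hw t ht ft fw hft hfw
    exact (h4 t (key w hw t ht) w hw ft fw hft hfw).1 ht
  · intro w hw fw hfw s hsw
    have hsY : Z.mem2 s Y := by
      rcases hDT w hw with h | rfl
      · exact hY.1 fw (h2 w h fw hfw) s hsw
      · rw [hf.2.2 _ _ _ hfw h5] at hsw
        exact hY.2.1 s hsw
    obtain ⟨t, ht, hts⟩ := h3 s hsY
    exact ⟨t, (h4 t ht w hw s fw hts hfw).2 hsw, hts⟩

/-- `f` and `f'` agree on common arguments. -/
theorem good_agree {x y f D x' y' f' D' : M} (g : Good Z x y f D) (g' : Good Z x' y' f' D') :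
    ∀ t, Z.mem1 t D → Z.mem1 t D' → ∀ b b', FunVal Z.mem1 f t b → FunVal Z.mem1 f' t b' →
      b = b' := by
  obtain ⟨c, hc⟩ := Z.sep1 (conj (.mem1 0 1) (ex 4 (ex 5
      (conj (fv 2 0 4) (conj (fv 3 0 5) (neg (.eq 4 5)))))))
    (fun n => if n = 1 then D' else if n = 2 then f else f') D
  simp [sat_conj, sat_ex, sat_neg, sat_fv, Fml.Sat, Function.update_apply] at hc
  by_contra hcon
  push Not at hcon
  obtain ⟨t, h1, h2, b, b', h3, h4, h5⟩ := hcon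
  obtain ⟨t, ht, hmin⟩ := Z.found1 c ⟨t, (hc t).2 ⟨h1, h2, b, h3, b', h4, h5⟩⟩
  obtain ⟨h1, h2, b, h3, b', h4, h5⟩ := (hc t).1 ht
  have ih : ∀ w, Z.mem1 w t → ∀ a a', FunVal Z.mem1 f w a → FunVal Z.mem1 f' w a' → a = a' := by
    intro w hw a a' ha ha'
    by_contra hne
    exact hmin w hw ((hc w).2 ⟨g.trans t h1 w hw, g'.trans t h2 w hw, a, ha, a', ha', hne⟩)
  apply h5
  apply Z.ext2
  intro s
  constructor
  · intro hs
    obtain ⟨w, hw, hws⟩ := g.bwd t h1 b h3 s hs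
    obtain ⟨a', ha'⟩ := g'.tot w (g'.trans t h2 w hw)
    rw [ih w hw s a' hws ha']
    exact g'.fwd t h2 w hw _ _ ha' h4
  · intro hs
    obtain ⟨w, hw, hws⟩ := g'.bwd t h2 b' h4 s hs
    obtain ⟨a, ha⟩ := g.tot w (g.trans t h1 w hw)
    rw [← ih w hw a s ha hws]
    exact g.fwd t h1 w hw _ _ ha h3

/-- `f` and `f'` are jointly injective. -/
theorem good_inj {x y f D x' y' f' D' : M} (g : Good Z x y f D) (g' : Good Z x' y' f' D') :
    ∀ t, Z.mem1 t D → ∀ t', Z.mem1 t' D' → ∀ b, FunVal Z.mem1 f t b → FunVal Z.mem1 f' t' b →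
      t = t' := by
  obtain ⟨c, hc⟩ := Z.sep1 (ex 4 (conj (.mem1 4 1) (ex 5
      (conj (fv 2 0 5) (conj (fv 3 4 5) (neg (.eq 0 4)))))))
    (fun n => if n = 1 then D' else if n = 2 then f else f') D
  simp [sat_conj, sat_ex, sat_neg, sat_fv, Fml.Sat, Function.update_apply] at hc
  by_contra hcon
  push Not at hcon
  obtain ⟨t, h1, t', h2, b, h3, h4, h5⟩ := hcon
  obtain ⟨t, ht, hmin⟩ := Z.found1 c ⟨t, (hc t).2 ⟨h1, t', h2, b, h3, h4, h5⟩⟩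
  obtain ⟨h1, t', h2, b, h3, h4, h5⟩ := (hc t).1 ht
  have ih : ∀ w, Z.mem1 w t → ∀ w', Z.mem1 w' D' → ∀ a, FunVal Z.mem1 f w a →
      FunVal Z.mem1 f' w' a → w = w' := by
    intro w hw w' hw' a ha ha'
    by_contra hne
    exact hmin w hw ((hc w).2 ⟨g.trans t h1 w hw, w', hw', a, ha, ha', hne⟩)
  apply h5
  apply Z.ext1
  intro u
  constructor
  · intro hu
    obtain ⟨a, ha⟩ := g.tot u (g.trans t h1 u hu)
    obtain ⟨u', hu', ha'⟩ := g'.bwd t' h2 b h4 a (g.fwd t h1 u hu _ _ ha h3)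
    rw [ih u hu u' (g'.trans t' h2 u' hu') a ha ha']
    exact hu'
  · intro hu
    obtain ⟨a, ha⟩ := g'.tot u (g'.trans t' h2 u hu)
    obtain ⟨w, hw, hwa⟩ := g.bwd t h1 b h3 a (g'.fwd t' h2 u hu _ _ ha h4)
    rw [← ih w hw u (g'.trans t' h2 u hu) a hwa ha]
    exact hw

end Aux

/-- In a model of `ZFC(∈₁) ∪ ZFC(∈₂)`: if `φ(x, y)` and `φ(x', y')` hold,
then `x ∈₁ x'` if and only if `y ∈₂ y'`. -/
theorem phi_preserves_membership {M : Type u} (Z : ZFC2Model M)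
    (x x' y y' : M) (h : Phi Z.mem1 Z.mem2 x y) (h' : Phi Z.mem1 Z.mem2 x' y') :
    Z.mem1 x x' ↔ Z.mem2 y y' := by
  obtain ⟨f, hf⟩ := h
  obtain ⟨f', hf'⟩ := h'
  obtain ⟨D, g⟩ := good_of_psi Z hf
  obtain ⟨D', g'⟩ := good_of_psi Z hf'
  constructor
  · intro hx
    have hxD := g'.trans x' g'.xD x hx
    obtain ⟨b, hb⟩ := g'.tot x hxD
    rw [good_agree Z g g' x g.xD hxD y b g.val hb]
    exact g'.fwd x' g'.xD x hx _ _ hb g'.val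
  · intro hy
    obtain ⟨w, hw, hwy⟩ := g'.bwd x' g'.xD y' g'.val y hy
    rw [good_inj Z g g' x g.xD w (g'.trans x' g'.xD w hw) y g.val hwy]
    exact hw
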